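/- arXiv:1801.00921 — 3 statements merged into one kernel-verified Lean document; each statement's English description precedes it below -/
import Mathlib

section
/- Let A, B, C, C' be multiplicative characters on F_q and let x, y ∈ F_q with x ≠ 1 and y ≠ 1. Then Ā(1-x)·B̄(1-y)·F₄*(A; B; C, C'; -x/((1-x)(1-y)), -y/((1-x)(1-y))) = (1/(q-1)²) · Σ_{χ,ψ over all multiplicative characters of F_q} ₂F₁*(χ̄, Aψ; C' | 1) · ₂F₁*(ψ̄, Bχ; C | 1) · [g(Aψ)g(Bχ)g(χ̄)g(ψ̄)/(g(A)g(B))] · ψ(-x)χ(-y). -/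
/-- Multiplicative characters of a finite field with values in `ℂ` form a finite type. -/
noncomputable instance mulCharFintypeC (F : Type*) [Field F] [Fintype F] :
    Fintype (MulChar F ℂ) :=
  Fintype.ofFinite _

/-- The canonical additive character `θ(α) = ζ^{tr(α)}` of a finite field `F` of
characteristic `p`, where `ζ` is a fixed primitive `p`-th root of unity in `ℂ`
and `tr` is the trace map to `ZMod p = F_p`. -/
noncomputable def addCharTheta (p : ℕ) (F : Type*) [Field F] [Fintype F]
    [Algebra (ZMod p) F] (zeta : ℂ) (a : F) : ℂ :=
  zeta ^ (Algebra.trace (ZMod p) F a).val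

/-- The Gauss sum `g(χ) = ∑_{x ∈ F} χ(x) θ(x)`. -/
noncomputable def gaussS (p : ℕ) (F : Type*) [Field F] [Fintype F]
    [Algebra (ZMod p) F] (zeta : ℂ) (χ : MulChar F ℂ) : ℂ :=
  ∑ x : F, χ x * addCharTheta p F zeta x

/-- McCarthy's finite field hypergeometric function
`₂F₁*(A₀, A₁; B₁ | x) = (1/(q-1)) ∑_χ [g(A₀χ)g(A₁χ)g((B₁χ)⁻¹)g(χ⁻¹)/(g(A₀)g(A₁)g(B₁⁻¹))] χ(x)`. -/
noncomputable def mcCarthy2F1 (p : ℕ) (F : Type*) [Field F] [Fintype F]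
    [Algebra (ZMod p) F] (zeta : ℂ) (A₀ A₁ B₁ : MulChar F ℂ) (x : F) : ℂ :=
  (1 / ((Fintype.card F : ℂ) - 1)) * ∑ χ : MulChar F ℂ,
    gaussS p F zeta (A₀ * χ) * gaussS p F zeta (A₁ * χ) * gaussS p F zeta (B₁ * χ)⁻¹ *
      gaussS p F zeta χ⁻¹ /
        (gaussS p F zeta A₀ * gaussS p F zeta A₁ * gaussS p F zeta B₁⁻¹) * χ x

/-- The finite field Appell function `F₄*(A; B; C, C'; x, y)`. -/
noncomputable def appellF4star (p : ℕ) (F : Type*) [Field F] [Fintype F]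
    [Algebra (ZMod p) F] (zeta : ℂ) (A B C C' : MulChar F ℂ) (x y : F) : ℂ :=
  (1 / ((Fintype.card F : ℂ) - 1) ^ 2) * ∑ ψ : MulChar F ℂ, ∑ χ : MulChar F ℂ,
    gaussS p F zeta (A * χ * ψ) * gaussS p F zeta (B * χ * ψ) * gaussS p F zeta (C * ψ)⁻¹ *
      gaussS p F zeta (C' * χ)⁻¹ * gaussS p F zeta ψ⁻¹ * gaussS p F zeta χ⁻¹ /
        (gaussS p F zeta A * gaussS p F zeta B * gaussS p F zeta C⁻¹ *
          gaussS p F zeta C'⁻¹) *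
      (ψ x * χ y)

/-- The finite field Appell function `F₁*(A; B, B'; C; x, y)`. -/
noncomputable def appellF1star (p : ℕ) (F : Type*) [Field F] [Fintype F]
    [Algebra (ZMod p) F] (zeta : ℂ) (A B B' C : MulChar F ℂ) (x y : F) : ℂ :=
  (1 / ((Fintype.card F : ℂ) - 1) ^ 2) * ∑ ψ : MulChar F ℂ, ∑ χ : MulChar F ℂ,
    gaussS p F zeta (A * χ * ψ) * gaussS p F zeta (B * ψ) * gaussS p F zeta (B' * χ) *
      gaussS p F zeta (C * χ * ψ)⁻¹ * gaussS p F zeta ψ⁻¹ * gaussS p F zeta χ⁻¹ /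
        (gaussS p F zeta A * gaussS p F zeta B * gaussS p F zeta B' *
          gaussS p F zeta C⁻¹) *
      (ψ x * χ y)

/-- The Jacobi sum `J(A,B) = ∑_{x ∈ F} A(x) B(1-x)`. -/
noncomputable def jacobiS (F : Type*) [Field F] [Fintype F] (A B : MulChar F ℂ) : ℂ :=
  ∑ x : F, A x * B (1 - x)

/-- Greene's binomial coefficient `(A choose B) = (B(-1)/q) J(A, B⁻¹)`. -/
noncomputable def binomChar (F : Type*) [Field F] [Fintype F] (A B : MulChar F ℂ) : ℂ :=
  (B (-1) / (Fintype.card F : ℂ)) * jacobiS F A B⁻¹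

open Finset in
/-- Orthogonality of the multiplicative characters of a finite field. -/
lemma sum_mulChar_mul_inv_eq_ite {F : Type*} [Field F] [Fintype F] [DecidableEq F] {c : F}
    (hc : c ≠ 0) (b : F) :
    ∑ χ : MulChar F ℂ, χ c * χ⁻¹ b = if b = c then (Fintype.card F : ℂ) - 1 else 0 := by
  split_ifs with h
  · have hcard : Fintype.card (MulChar F ℂ) = Fintype.card F - 1 := by
      rw [← Nat.card_eq_fintype_card, MulChar.card_eq_card_units_of_hasEnoughRootsOfUnity,
        Nat.card_eq_fintype_card, Fintype.card_units]
    have hone (χ : MulChar F ℂ) : χ c * χ⁻¹ c = 1 := by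
      rw [← MulChar.mul_apply, mul_inv_cancel, MulChar.one_apply hc.isUnit]
    rw [h, sum_congr rfl fun χ _ => hone χ]
    simp [hcard, Nat.cast_sub Fintype.card_pos]
  · have hcb : c * b⁻¹ ≠ 1 := fun h1 => h (mul_inv_eq_one₀ (by
      rintro rfl
      simp at h1) |>.mp h1).symm
    obtain ⟨φ, hφ⟩ := MulChar.exists_apply_ne_one_of_hasEnoughRootsOfUnity F ℂ hcb
    refine eq_zero_of_mul_eq_self_left hφ ?_
    simp only [MulChar.inv_apply', ← map_mul, mul_sum, ← MulChar.mul_apply]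
    exact Fintype.sum_equiv (Equiv.mulLeft φ) _ _ fun χ => by simp

/-- The finite field binomial theorem in terms of Gauss sums. -/
lemma sum_gaussSum_mul_gaussSum_inv_mul {F : Type*} [Field F] [Fintype F] (θ : AddChar F ℂ)
    (A : MulChar F ℂ) {t : F} (ht : t ≠ 0) (ht' : 1 + t ≠ 0) :
    ∑ ψ : MulChar F ℂ, gaussSum (A * ψ) θ * gaussSum ψ⁻¹ θ * ψ t =
      ((Fintype.card F : ℂ) - 1) * (gaussSum A θ * A⁻¹ (1 + t)) := by
  classical
  have hshift : gaussSum A (θ.mulShift (1 + t)) = A⁻¹ (1 + t) * gaussSum A θ :=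
    gaussSum_mulShift_eq A θ (Units.mk0 _ ht')
  rw [mul_comm (gaussSum A θ), ← hshift]
  simp only [gaussSum, Finset.sum_mul]
  rw [Finset.sum_comm, Finset.mul_sum]
  refine Finset.sum_congr rfl fun a _ => ?_
  rcases eq_or_ne a 0 with rfl | ha
  · simp [MulChar.map_zero]
  simp only [Finset.mul_sum, Finset.sum_mul]
  rw [Finset.sum_comm]
  have hb (b : F) : ∑ ψ : MulChar F ℂ, (A * ψ) a * θ a * (ψ⁻¹ b * θ b) * ψ t =
      A a * θ a * θ b * if b = a * t then (Fintype.card F : ℂ) - 1 else 0 := by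
    rw [← sum_mulChar_mul_inv_eq_ite (mul_ne_zero ha ht) b, Finset.mul_sum]
    refine Finset.sum_congr rfl fun ψ _ => ?_
    rw [MulChar.mul_apply, map_mul]
    ring
  simp only [hb, mul_ite, mul_zero, Finset.sum_ite_eq', Finset.mem_univ, if_true]
  rw [AddChar.mulShift_apply, show (1 + t) * a = a + a * t by ring, AddChar.map_add_eq_mul]
  ring

lemma sum_gaussSum_mul_gaussSum_inv_mul_shift {F : Type*} [Field F] [Fintype F]
    (θ : AddChar F ℂ) (A μ : MulChar F ℂ) {x : F} (hx : x ≠ 1) :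
    ∑ ψ : MulChar F ℂ, gaussSum (A * ψ) θ * gaussSum (ψ⁻¹ * μ) θ * ψ (-x) =
      ((Fintype.card F : ℂ) - 1) * (gaussSum (A * μ) θ * (A * μ)⁻¹ (1 - x) * μ (-x)) := by
  rcases eq_or_ne x 0 with rfl | h0
  · simp [MulChar.map_zero]
  have h1 : 1 + -x ≠ 0 := by
    rw [← sub_eq_add_neg]
    exact sub_ne_zero.mpr hx.symm
  have h := sum_gaussSum_mul_gaussSum_inv_mul θ (A * μ) (neg_ne_zero.mpr h0) h1
  rw [← sub_eq_add_neg] at h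
  rw [← mul_assoc, ← h, Finset.sum_mul, ← Equiv.sum_comp (Equiv.mulLeft μ)]
  refine Finset.sum_congr rfl fun ψ _ => ?_
  rw [Equiv.coe_mulLeft, mul_assoc A, MulChar.mul_apply μ ψ,
    show (μ * ψ)⁻¹ * μ = ψ⁻¹ by rw [mul_inv, mul_comm μ⁻¹, inv_mul_cancel_right]]
  ring

lemma gaussSum_ne_zero {F : Type*} [Field F] [Fintype F] {θ : AddChar F ℂ} (hθ : θ ≠ 1)
    (χ : MulChar F ℂ) : gaussSum χ θ ≠ 0 := by
  rcases eq_or_ne χ 1 with rfl | hχ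
  · simp [gaussSum_one_left hθ]
  · exact gaussSum_ne_zero_of_nontrivial (Nat.cast_ne_zero.mpr Fintype.card_ne_zero) hχ
      (AddChar.IsPrimitive.of_ne_one hθ)

lemma exists_addChar_gaussS_eq (p : ℕ) [Fact p.Prime] (F : Type*) [Field F] [Fintype F]
    [Algebra (ZMod p) F] {zeta : ℂ} (hzeta : IsPrimitiveRoot zeta p) :
    ∃ θ : AddChar F ℂ, θ ≠ 1 ∧ ∀ χ, gaussS p F zeta χ = gaussSum χ θ := by
  refine ⟨(AddChar.zmodChar p hzeta.pow_eq_one).compAddMonoidHom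
    (Algebra.trace (ZMod p) F).toAddMonoidHom, fun h => ?_, fun χ => rfl⟩
  obtain ⟨a, ha⟩ := Algebra.trace_surjective (ZMod p) F 1
  have h1 := DFunLike.congr_fun h a
  have hp : 1 < p := (Fact.out : p.Prime).one_lt
  have : Fact (1 < p) := ⟨hp⟩
  simp [AddChar.zmodChar_apply, ha, ZMod.val_one] at h1
  exact hzeta.ne_one hp h1

lemma mcCarthy2F1_one_mul_gaussS (p : ℕ) (F : Type*) [Field F] [Fintype F]
    [Algebra (ZMod p) F] (zeta : ℂ) {A₀ A₁ : MulChar F ℂ} (B₁ : MulChar F ℂ)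
    (h₀ : gaussS p F zeta A₀ ≠ 0) (h₁ : gaussS p F zeta A₁ ≠ 0) :
    mcCarthy2F1 p F zeta A₀ A₁ B₁ 1 * (gaussS p F zeta A₀ * gaussS p F zeta A₁) =
      (1 / ((Fintype.card F : ℂ) - 1)) * ∑ χ : MulChar F ℂ,
        gaussS p F zeta (A₀ * χ) * gaussS p F zeta (A₁ * χ) * gaussS p F zeta (B₁ * χ)⁻¹ *
          gaussS p F zeta χ⁻¹ / gaussS p F zeta B₁⁻¹ := by
  rw [mcCarthy2F1, mul_assoc, Finset.sum_mul]
  congr 1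
  refine Finset.sum_congr rfl fun χ _ => ?_
  rw [map_one]
  field_simp

lemma inv_apply_mul_inv_apply_mul_apply_neg_div {F : Type*} [Field F] (A B μ ν : MulChar F ℂ)
    (x y : F) :
    A⁻¹ (1 - x) * B⁻¹ (1 - y) *
        (μ (-x / ((1 - x) * (1 - y))) * ν (-y / ((1 - x) * (1 - y)))) =
      ((A * ν * μ)⁻¹ (1 - x) * μ (-x)) * ((B * μ * ν)⁻¹ (1 - y) * ν (-y)) := by
  simp only [mul_inv, MulChar.mul_apply, MulChar.inv_apply', div_eq_mul_inv, map_mul]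
  ring

theorem stmt0    (p : ℕ) [Fact p.Prime] (hp : p ≠ 2) (F : Type*) [Field F] [Fintype F]
    [Algebra (ZMod p) F] (zeta : ℂ) (hzeta : IsPrimitiveRoot zeta p)
    (A B C C' : MulChar F ℂ) (x y : F) (hx : x ≠ 1) (hy : y ≠ 1) :
    A⁻¹ (1 - x) * B⁻¹ (1 - y) *
      appellF4star p F zeta A B C C' (-x / ((1 - x) * (1 - y))) (-y / ((1 - x) * (1 - y))) =
    (1 / ((Fintype.card F : ℂ) - 1) ^ 2) * ∑ χ : MulChar F ℂ, ∑ ψ : MulChar F ℂ,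
      mcCarthy2F1 p F zeta χ⁻¹ (A * ψ) C' 1 * mcCarthy2F1 p F zeta ψ⁻¹ (B * χ) C 1 *
        (gaussS p F zeta (A * ψ) * gaussS p F zeta (B * χ) * gaussS p F zeta (χ⁻¹) * gaussS p F zeta (ψ⁻¹) /
          (gaussS p F zeta (A) * gaussS p F zeta (B))) * (ψ (-x) * χ (-y)) := by
  obtain ⟨θ, hθ, hg⟩ := exists_addChar_gaussS_eq p F hzeta
  have hne (χ : MulChar F ℂ) : gaussS p F zeta χ ≠ 0 := hg χ ▸ gaussSum_ne_zero hθ χ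
  have hq : (Fintype.card F : ℂ) - 1 ≠ 0 :=
    sub_ne_zero.mpr (Nat.cast_ne_one.mpr Fintype.one_lt_card.ne')
  have hterm (χ ψ : MulChar F ℂ) :
      mcCarthy2F1 p F zeta χ⁻¹ (A * ψ) C' 1 * mcCarthy2F1 p F zeta ψ⁻¹ (B * χ) C 1 *
        (gaussS p F zeta (A * ψ) * gaussS p F zeta (B * χ) * gaussS p F zeta (χ⁻¹) *
          gaussS p F zeta (ψ⁻¹) / (gaussS p F zeta (A) * gaussS p F zeta (B))) *
            (ψ (-x) * χ (-y)) =
      ∑ μ : MulChar F ℂ, ∑ ν : MulChar F ℂ,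
        (gaussS p F zeta (C * μ)⁻¹ * gaussS p F zeta (C' * ν)⁻¹ * gaussS p F zeta μ⁻¹ *
          gaussS p F zeta ν⁻¹ / (gaussS p F zeta A * gaussS p F zeta B *
            gaussS p F zeta C⁻¹ * gaussS p F zeta C'⁻¹) / ((Fintype.card F : ℂ) - 1) ^ 2) *
        ((gaussS p F zeta (B * μ * χ) * gaussS p F zeta (χ⁻¹ * ν) * χ (-y)) *
          (gaussS p F zeta (A * ν * ψ) * gaussS p F zeta (ψ⁻¹ * μ) * ψ (-x))) := by
    calc
      _ = (mcCarthy2F1 p F zeta ψ⁻¹ (B * χ) C 1 *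
            (gaussS p F zeta ψ⁻¹ * gaussS p F zeta (B * χ))) *
          (mcCarthy2F1 p F zeta χ⁻¹ (A * ψ) C' 1 *
            (gaussS p F zeta χ⁻¹ * gaussS p F zeta (A * ψ))) *
          ((ψ (-x) * χ (-y)) / (gaussS p F zeta A * gaussS p F zeta B)) := by ring
      _ = _ := by
        rw [mcCarthy2F1_one_mul_gaussS p F zeta C (hne ψ⁻¹) (hne (B * χ)),
          mcCarthy2F1_one_mul_gaussS p F zeta C' (hne χ⁻¹) (hne (A * ψ)), mul_mul_mul_comm,
          Finset.sum_mul_sum, mul_assoc, Finset.sum_mul, Finset.mul_sum]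
        refine Finset.sum_congr rfl fun μ _ => ?_
        rw [Finset.sum_mul, Finset.mul_sum]
        refine Finset.sum_congr rfl fun ν _ => ?_
        rw [mul_right_comm A, mul_right_comm B]
        generalize (Fintype.card F : ℂ) - 1 = q
        ring
  have hswap (f : MulChar F ℂ → MulChar F ℂ → MulChar F ℂ → MulChar F ℂ → ℂ) :
      ∑ χ, ∑ ψ, ∑ μ, ∑ ν, f χ ψ μ ν = ∑ μ, ∑ ν, ∑ χ, ∑ ψ, f χ ψ μ ν := by
    calc
      _ = ∑ χ, ∑ μ, ∑ ψ, ∑ ν, f χ ψ μ ν := Finset.sum_congr rfl fun _ _ => Finset.sum_comm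
      _ = ∑ μ, ∑ χ, ∑ ν, ∑ ψ, f χ ψ μ ν := by
        rw [Finset.sum_comm]
        exact Finset.sum_congr rfl fun _ _ => Finset.sum_congr rfl fun _ _ => Finset.sum_comm
      _ = _ := Finset.sum_congr rfl fun _ _ => Finset.sum_comm
  simp only [hterm]
  rw [hswap, appellF4star, mul_left_comm, Finset.mul_sum]
  congr 1
  refine Finset.sum_congr rfl fun μ _ => ?_
  rw [Finset.mul_sum]
  refine Finset.sum_congr rfl fun ν _ => ?_
  simp only [← Finset.mul_sum, ← Finset.sum_mul]
  simp only [hg, sum_gaussSum_mul_gaussSum_inv_mul_shift θ _ _ hx,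
    sum_gaussSum_mul_gaussSum_inv_mul_shift θ _ _ hy]
  rw [mul_left_comm, inv_apply_mul_inv_apply_mul_apply_neg_div A B μ ν x y,
    mul_right_comm B ν μ]
  simp only [hg] at hne
  field_simp [hne]
end

section
/- Let A, B, C be multiplicative characters on F_q with A ≠ ε, B ≠ ε, C ≠ ε, B ≠ C and A ≠ C, and let x, y ∈ F_q with x ≠ 1, y ≠ 1 and xy ≠ 1. Then F₄*(A; B; C, ABC̄; -x/((1-x)(1-y)), -y/((1-x)(1-y))) = ₂F₁*(A, B; C | -x/(1-x)) · ₂F₁*(A, B; ABC̄ | -y/(1-y)). -/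
open Finset in
theorem FiniteField.sum_units_mulChar {F : Type*} [Field F] [Fintype F] [DecidableEq F]
    (χ : MulChar F ℂ)
    (f : F → ℂ) : ∑ a : Fˣ, χ a * f a = ∑ a : F, χ a * f a := by
  rw [← Finset.sum_filter_add_sum_filter_not univ (fun a : F => a ≠ 0)]
  rw [Finset.sum_eq_zero (s := univ.filter fun a : F => ¬ a ≠ 0), add_zero]
  · refine Finset.sum_bij (fun a _ => (a : F)) (by simp) (by simp [Units.ext_iff]) ?_ (by simp)
    intro b hb
    exact ⟨Units.mk0 b (by simpa using hb), by simp, by simp⟩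
  · intro a ha
    have : a = 0 := by simpa using ha
    simp [this, MulChar.map_zero]

theorem gaussSum_eq_sum_units {F : Type*} [Field F] [Fintype F] [DecidableEq F]
    (χ : MulChar F ℂ)
    (θ : AddChar F ℂ) : gaussSum χ θ = ∑ a : Fˣ, χ a * θ a :=
  (FiniteField.sum_units_mulChar χ θ).symm

theorem sum_mul_gaussSum_mul {F ι : Type*} [Field F] [Fintype F] [DecidableEq F] [Fintype ι]
    (θ : AddChar F ℂ) (s : ι → MulChar F ℂ) (c h : ι → ℂ) :
    ∑ i, c i * (gaussSum (s i) θ * h i) = ∑ a : Fˣ, θ a * ∑ i, c i * s i a * h i := by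
  simp_rw [Finset.mul_sum]
  rw [Finset.sum_comm]
  refine Finset.sum_congr rfl fun i _ => ?_
  rw [gaussSum_eq_sum_units, Finset.sum_mul, Finset.mul_sum]
  exact Finset.sum_congr rfl fun a _ => by ring

theorem sum_units_mulChar_mul_addChar {F : Type*} [Field F] [Fintype F] [DecidableEq F]
    {χ : MulChar F ℂ}
    (hχ : χ ≠ 1) (θ : AddChar F ℂ) (t : F) :
    ∑ a : Fˣ, χ a * θ (a * t) = gaussSum χ θ * (χ t)⁻¹ := by
  rw [FiniteField.sum_units_mulChar χ (fun a => θ (a * t))]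
  by_cases ht : t = 0
  · simp [ht, MulChar.map_zero, MulChar.sum_eq_zero_of_ne_one hχ]
  · have := gaussSum_mulShift_eq χ θ (Units.mk0 t ht)
    rw [MulChar.inv_apply_eq_inv', Units.val_mk0] at this
    rw [mul_comm (gaussSum χ θ), ← this, gaussSum]
    exact Finset.sum_congr rfl fun a _ => by rw [AddChar.mulShift_apply, mul_comm t]

theorem sum_mulChar_apply {F : Type*} [Field F] [Fintype F] [DecidableEq F] (a : F) :
    ∑ χ : MulChar F ℂ, χ a = if a = 1 then (Fintype.card F : ℂ) - 1 else 0 := by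
  split_ifs with ha
  · have h : Fintype.card (MulChar F ℂ) = Fintype.card Fˣ := by
      simpa only [Nat.card_eq_fintype_card] using
        MulChar.card_eq_card_units_of_hasEnoughRootsOfUnity F ℂ
    simp only [ha, map_one, Finset.sum_const, Finset.card_univ, nsmul_eq_mul, mul_one, h,
      Fintype.card_units]
    rw [Nat.cast_sub Fintype.card_pos, Nat.cast_one]
  · obtain ⟨χ, hχ⟩ := MulChar.exists_apply_ne_one_of_hasEnoughRootsOfUnity F ℂ ha
    refine eq_zero_of_mul_eq_self_left hχ ?_
    simp only [Finset.mul_sum, ← MulChar.mul_apply]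
    exact Fintype.sum_bijective _ (Group.mulLeft_bijective χ) _ _ fun χ' ↦ rfl

theorem sum_gaussSum_inv_mul_apply {F : Type*} [Field F] [Fintype F] [DecidableEq F]
    (θ : AddChar F ℂ) {t : F}
    (ht : t ≠ 0) :
    ∑ χ : MulChar F ℂ, gaussSum χ⁻¹ θ * χ t = ((Fintype.card F : ℂ) - 1) * θ t := by
  have h (a : Fˣ) : ∑ χ : MulChar F ℂ, 1 * χ⁻¹ a * χ t =
      if Units.mk0 t ht = a then ((Fintype.card F : ℂ) - 1) else 0 := by
    simp_rw [one_mul, MulChar.inv_apply', ← map_mul, sum_mulChar_apply]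
    have : (a : F)⁻¹ * t = 1 ↔ Units.mk0 t ht = a := by
      rw [inv_mul_eq_one₀ a.ne_zero, Units.ext_iff, eq_comm, Units.val_mk0]
    simp only [this]
  have := sum_mul_gaussSum_mul θ (fun χ : MulChar F ℂ => χ⁻¹) (fun _ => 1) (fun χ => χ t)
  simp only [h] at this
  simpa [mul_comm] using this

theorem sum_gaussSum_twoFOne {F : Type*} [Field F] [Fintype F] [DecidableEq F] (θ : AddChar F ℂ)
    {A B C : MulChar F ℂ} (hB : B ≠ 1) (hAC : A * C⁻¹ ≠ 1) {z : F} (hz : z ≠ 0) :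
    ∑ χ : MulChar F ℂ, gaussSum (A * χ) θ * gaussSum (B * χ) θ * gaussSum (C * χ)⁻¹ θ *
        gaussSum χ⁻¹ θ * χ z =
      ((Fintype.card F : ℂ) - 1) * (gaussSum (A * C⁻¹) θ * gaussSum B θ *
        ∑ c : F, C⁻¹ c * (((A * C⁻¹) (1 + c))⁻¹ * (B (1 + z / c))⁻¹)) := by
  have inner (a b c : Fˣ) : ∑ χ : MulChar F ℂ, 1 * (A * χ) a * (B * χ) b * (C * χ)⁻¹ c *
      (gaussSum χ⁻¹ θ * χ z) = ((Fintype.card F : ℂ) - 1) *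
        (A a * B b * C⁻¹ c * θ (a * b * z / c)) := by
    rw [mul_left_comm, ← sum_gaussSum_inv_mul_apply θ (by simp [hz]), Finset.mul_sum]
    refine Finset.sum_congr rfl fun χ _ => ?_
    simp only [_root_.mul_inv, MulChar.mul_apply, div_eq_mul_inv, map_mul, MulChar.inv_apply']
    ring
  have key (a b : Fˣ) : ∑ c : Fˣ, θ c * (A a * B b * C⁻¹ c * θ (a * b * z / c)) * (θ a * θ b) =
      ∑ c : Fˣ, C⁻¹ c * (((A * C⁻¹) a * θ (a * (1 + c))) * (B b * θ (b * (1 + z / c)))) := by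
    rw [← Equiv.sum_comp (Equiv.mulLeft a)]
    refine Finset.sum_congr rfl fun c _ => ?_
    have h1 : (a * b * z / (a * c : F) : F) = b * (z / c) := by
      field_simp [a.ne_zero, c.ne_zero]
    simp only [Equiv.coe_mulLeft, Units.val_mul, h1, mul_add, mul_one, AddChar.map_add_eq_mul,
      MulChar.mul_apply, map_mul]
    ring
  calc
    _ = ∑ χ : MulChar F ℂ, 1 * (gaussSum (A * χ) θ * (gaussSum (B * χ) θ *
          (gaussSum (C * χ)⁻¹ θ * (gaussSum χ⁻¹ θ * χ z)))) :=
      Finset.sum_congr rfl fun χ _ => by ring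
    _ = ((Fintype.card F : ℂ) - 1) * ∑ a : Fˣ, ∑ b : Fˣ, ∑ c : Fˣ,
          θ c * (A a * B b * C⁻¹ c * θ (a * b * z / c)) * (θ a * θ b) := by
      simp_rw [sum_mul_gaussSum_mul θ (fun χ => A * χ), sum_mul_gaussSum_mul θ (fun χ => B * χ),
        sum_mul_gaussSum_mul θ (fun χ => (C * χ)⁻¹), inner, Finset.mul_sum]
      refine Finset.sum_congr rfl fun a _ => Finset.sum_congr rfl fun b _ =>
        Finset.sum_congr rfl fun c _ => ?_
      ring
    _ = ((Fintype.card F : ℂ) - 1) * ∑ c : Fˣ, C⁻¹ c *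
          ((∑ a : Fˣ, (A * C⁻¹) a * θ (a * (1 + c))) * ∑ b : Fˣ, B b * θ (b * (1 + z / c))) := by
      refine congrArg _ ?_
      simp_rw [key, Finset.sum_mul_sum, Finset.mul_sum]
      rw [Finset.sum_comm_cycle]
    _ = _ := by
      simp_rw [sum_units_mulChar_mul_addChar hAC, sum_units_mulChar_mul_addChar hB]
      rw [FiniteField.sum_units_mulChar C⁻¹ (fun c => gaussSum (A * C⁻¹) θ *
        ((A * C⁻¹) (1 + c))⁻¹ * (gaussSum B θ * (B (1 + z / c))⁻¹))]
      refine congrArg _ ?_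
      rw [Finset.mul_sum]
      exact (Finset.sum_congr rfl fun c _ => by ring)

theorem sum_gaussSum_appellFour {F : Type*} [Field F] [Fintype F] [DecidableEq F]
    (θ : AddChar F ℂ) {A B C : MulChar F ℂ} (hAC : A * C⁻¹ ≠ 1) {x y : F} (hx : x ≠ 0)
    (hy : y ≠ 0) :
    ∑ ψ : MulChar F ℂ, ∑ χ : MulChar F ℂ, gaussSum (A * χ * ψ) θ * gaussSum (B * χ * ψ) θ *
        gaussSum (C * ψ)⁻¹ θ * gaussSum (A * B * C⁻¹ * χ)⁻¹ θ * gaussSum ψ⁻¹ θ *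
        gaussSum χ⁻¹ θ * (ψ x * χ y) =
      ((Fintype.card F : ℂ) - 1) ^ 2 * (gaussSum (A * C⁻¹) θ * gaussSum (A * C⁻¹)⁻¹ θ *
        ∑ c : F, ∑ d : F, C⁻¹ c * (A * B * C⁻¹)⁻¹ d *
          (((A * C⁻¹) (1 + c + y / d))⁻¹ * (A * C⁻¹) (1 + d + x / c))) := by
  have inner (a b c d : Fˣ) : ∑ i : MulChar F ℂ × MulChar F ℂ, 1 * (A * i.2 * i.1) a *
      (B * i.2 * i.1) b * (C * i.1)⁻¹ c * (A * B * C⁻¹ * i.2)⁻¹ d *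
      (gaussSum i.1⁻¹ θ * gaussSum i.2⁻¹ θ * (i.1 x * i.2 y)) =
        ((Fintype.card F : ℂ) - 1) ^ 2 * (A a * B b * C⁻¹ c * (A * B * C⁻¹)⁻¹ d *
          (θ (a * b * x / c) * θ (a * b * y / d))) := by
    rw [show ((Fintype.card F : ℂ) - 1) ^ 2 * (A a * B b * C⁻¹ c * (A * B * C⁻¹)⁻¹ d *
          (θ (a * b * x / c) * θ (a * b * y / d))) = A a * B b * C⁻¹ c * (A * B * C⁻¹)⁻¹ d *
          ((((Fintype.card F : ℂ) - 1) * θ (a * b * x / c)) *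
            (((Fintype.card F : ℂ) - 1) * θ (a * b * y / d))) by ring,
      ← sum_gaussSum_inv_mul_apply θ (by simp [hx]), ← sum_gaussSum_inv_mul_apply θ (by simp [hy]),
      Finset.sum_mul_sum, ← Finset.sum_product', Finset.univ_product_univ, Finset.mul_sum]
    refine Finset.sum_congr rfl fun χ _ => ?_
    simp only [_root_.mul_inv, inv_inv, MulChar.mul_apply, div_eq_mul_inv, map_mul,
      MulChar.inv_apply']
    ring
  have key (a b : Fˣ) : ∑ c : Fˣ, ∑ d : Fˣ, θ c * θ d * (A a * B b * C⁻¹ c *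
        (A * B * C⁻¹)⁻¹ d * (θ (a * b * x / c) * θ (a * b * y / d))) * (θ a * θ b) =
      ∑ c : Fˣ, ∑ d : Fˣ, C⁻¹ c * (A * B * C⁻¹)⁻¹ d *
        (((A * C⁻¹) a * θ (a * (1 + c + y / d))) *
          ((A * C⁻¹)⁻¹ b * θ (b * (1 + d + x / c)))) := by
    rw [← Equiv.sum_comp (Equiv.mulLeft a)]
    refine Finset.sum_congr rfl fun c _ => ?_
    rw [← Equiv.sum_comp (Equiv.mulLeft b)]
    refine Finset.sum_congr rfl fun d _ => ?_
    have h1 : (a * b * x / (a * c : F) : F) = b * (x / c) := by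
      field_simp [a.ne_zero, c.ne_zero]
    have h2 : (a * b * y / (b * d : F) : F) = a * (y / d) := by
      field_simp [b.ne_zero, d.ne_zero]
    have hb : B b ≠ 0 := MulChar.apply_ne_zero_iff.2 b.isUnit
    simp only [Equiv.coe_mulLeft, Units.val_mul, h1, h2, mul_add, mul_one,
      AddChar.map_add_eq_mul, MulChar.mul_apply, map_mul, MulChar.inv_apply_eq_inv', mul_inv,
      inv_inv]
    refine Eq.trans ?_ ((congrArg (· * _) (mul_inv_cancel₀ hb)).trans (one_mul _))
    ring
  calc
    _ = ∑ i : MulChar F ℂ × MulChar F ℂ, 1 * (gaussSum (A * i.2 * i.1) θ *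
          (gaussSum (B * i.2 * i.1) θ * (gaussSum (C * i.1)⁻¹ θ *
          (gaussSum (A * B * C⁻¹ * i.2)⁻¹ θ *
          (gaussSum i.1⁻¹ θ * gaussSum i.2⁻¹ θ * (i.1 x * i.2 y)))))) := by
      rw [← Finset.sum_product', Finset.univ_product_univ]
      exact Finset.sum_congr rfl fun χ _ => by ring
    _ = ((Fintype.card F : ℂ) - 1) ^ 2 * ∑ a : Fˣ, ∑ b : Fˣ, ∑ c : Fˣ, ∑ d : Fˣ,
          θ c * θ d * (A a * B b * C⁻¹ c *
            (A * B * C⁻¹)⁻¹ d * (θ (a * b * x / c) * θ (a * b * y / d))) * (θ a * θ b) := by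
      simp_rw [sum_mul_gaussSum_mul θ (fun i : MulChar F ℂ × MulChar F ℂ => A * i.2 * i.1),
        sum_mul_gaussSum_mul θ (fun i : MulChar F ℂ × MulChar F ℂ => B * i.2 * i.1),
        sum_mul_gaussSum_mul θ (fun i : MulChar F ℂ × MulChar F ℂ => (C * i.1)⁻¹),
        sum_mul_gaussSum_mul θ (fun i : MulChar F ℂ × MulChar F ℂ => (A * B * C⁻¹ * i.2)⁻¹),
        inner, Finset.mul_sum]
      refine Finset.sum_congr rfl fun a _ => Finset.sum_congr rfl fun b _ =>
        Finset.sum_congr rfl fun c _ => Finset.sum_congr rfl fun d _ => ?_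
      ring
    _ = ((Fintype.card F : ℂ) - 1) ^ 2 * ∑ c : Fˣ, ∑ d : Fˣ, C⁻¹ c * (A * B * C⁻¹)⁻¹ d *
        ((∑ a : Fˣ, (A * C⁻¹) a * θ (a * (1 + c + y / d))) *
          ∑ b : Fˣ, (A * C⁻¹)⁻¹ b * θ (b * (1 + d + x / c))) := by
      refine congrArg _ ?_
      simp_rw [key, Finset.sum_mul_sum, Finset.mul_sum]
      rw [Finset.sum_comm_cycle]
      refine Finset.sum_congr rfl fun c _ => ?_
      rw [Finset.sum_comm_cycle]
    _ = _ := by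
      have hAC' : (A * C⁻¹)⁻¹ ≠ 1 := inv_ne_one.2 hAC
      simp_rw [sum_units_mulChar_mul_addChar hAC, sum_units_mulChar_mul_addChar hAC']
      simp_rw [mul_assoc (C⁻¹ _), ← Finset.mul_sum _ _ (C⁻¹ _)]
      rw [FiniteField.sum_units_mulChar C⁻¹ (fun c => ∑ d : Fˣ, (A * B * C⁻¹)⁻¹ d *
        (gaussSum (A * C⁻¹) θ * ((A * C⁻¹) (1 + c + y / d))⁻¹ * (gaussSum (A * C⁻¹)⁻¹ θ *
          ((A * C⁻¹)⁻¹ (1 + d + x / c))⁻¹)))]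
      refine congrArg (((Fintype.card F : ℂ) - 1) ^ 2 * ·) ?_
      rw [Finset.mul_sum]
      refine Finset.sum_congr rfl fun c _ => ?_
      rw [FiniteField.sum_units_mulChar (A * B * C⁻¹)⁻¹ (fun d =>
        gaussSum (A * C⁻¹) θ * ((A * C⁻¹) (1 + c + y / d))⁻¹ * (gaussSum (A * C⁻¹)⁻¹ θ *
          ((A * C⁻¹)⁻¹ (1 + d + x / c))⁻¹))]
      simp only [Finset.mul_sum]
      refine Finset.sum_congr rfl fun d _ => ?_
      rw [MulChar.inv_apply_eq_inv' (A * C⁻¹), inv_inv]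
      ring

theorem MulChar.apply_div {F : Type*} [Field F] (χ : MulChar F ℂ) (a b : F) :
    χ (a / b) = χ a / χ b := by
  rw [div_eq_mul_inv, map_mul, ← MulChar.inv_apply', MulChar.inv_apply_eq_inv', div_eq_mul_inv]

theorem MulChar.apply_ne_zero {F : Type*} [Field F] (χ : MulChar F ℂ) {a : F} (ha : a ≠ 0) :
    χ a ≠ 0 :=
  MulChar.apply_ne_zero_iff.2 (isUnit_iff_ne_zero.2 ha)

theorem MulChar.sum_ite_eq_zero_else {F : Type*} [Field F] [Fintype F] [DecidableEq F]
    {χ : MulChar F ℂ} (hχ : χ ≠ 1) (a : F) : ∑ c : F, (if c = a then 0 else χ c) = -χ a := by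
  have h (c : F) : (if c = a then 0 else χ c) = χ c - if c = a then χ c else 0 := by
    split_ifs <;> simp
  simp [h, Finset.sum_sub_distrib, MulChar.sum_eq_zero_of_ne_one hχ]

theorem MulChar.sum_apply_mul_apply_inv {F : Type*} [Field F] [Fintype F] [DecidableEq F]
    {χ : MulChar F ℂ} (hχ : χ ≠ 1) {a e : F} (ha : a ≠ 0) (he : a - e ≠ 0) :
    ∑ d : F, χ (1 + d) * (χ (a * d + e))⁻¹ = -(χ a)⁻¹ := by
  let σ : F ≃ F := ((Equiv.mulLeft₀ a ha).trans (Equiv.addRight e)).trans (Equiv.inv F)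
  let τ : F ≃ F := (Equiv.mulLeft₀ (a - e) he).trans (Equiv.addLeft 1)
  have h1 (d : F) : χ (1 + d) * (χ (a * d + e))⁻¹ =
      (χ a)⁻¹ * (if τ (σ d) = 1 then 0 else χ (τ (σ d))) := by
    have hτ : τ (σ d) = 1 + (a - e) * (a * d + e)⁻¹ := rfl
    rw [hτ]
    by_cases h : a * d + e = 0
    · simp [h]
    · have h2 : 1 + (a - e) * (a * d + e)⁻¹ = a * (1 + d) / (a * d + e) := by
        field_simp; ring
      rw [if_neg (by simp [h, he]), h2, MulChar.apply_div, map_mul]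
      have := χ.apply_ne_zero ha
      field_simp
  simp_rw [h1]
  rw [← Finset.mul_sum, Equiv.sum_comp σ (fun s => if τ s = 1 then 0 else χ (τ s)),
    Equiv.sum_comp τ (fun s => if s = 1 then 0 else χ s), MulChar.sum_ite_eq_zero_else hχ]
  simp

theorem MulChar.sum_inv_ite {F : Type*} [Field F] [Fintype F] [DecidableEq F]
    {χ : MulChar F ℂ} (hχ : χ ≠ 1) (a : F) :
    ∑ c : F, (if c = a then 0 else (χ c)⁻¹) = -(χ a)⁻¹ := by
  simpa [MulChar.inv_apply_eq_inv'] using MulChar.sum_ite_eq_zero_else (inv_ne_one.2 hχ) a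

/-- The summand of the double character sum for `F₄*`, up to normalization. -/
noncomputable def appellSummand {F : Type*} [Field F] (B C D : MulChar F ℂ) (α β c d : F) : ℂ :=
  (C c)⁻¹ * (B d * D d)⁻¹ *
    ((D (1 + c - β * (1 + α) / d))⁻¹ * D (1 + d - α * (1 + β) / c))

/-- The summand of the double character sum for a product of two `₂F₁*`, up to normalization. -/
noncomputable def productSummand {F : Type*} [Field F] (B C D : MulChar F ℂ) (α β c d : F) : ℂ :=
  (C c)⁻¹ * ((D (1 + c))⁻¹ * (B (1 - α / c))⁻¹) *
    ((B d * D d)⁻¹ * (D (1 + d) * (C (1 - β / d) * D (1 - β / d))⁻¹))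

section Summands

variable {F : Type*} [Field F] (B C D : MulChar F ℂ) {α β c d : F}

theorem appellSummand_of_eq_zero (h : c = 0 ∨ d = 0) : appellSummand B C D α β c d = 0 := by
  rcases h with rfl | rfl <;> simp [appellSummand, MulChar.map_zero]

theorem productSummand_of_eq_zero (h : c = 0 ∨ d = 0) : productSummand B C D α β c d = 0 := by
  rcases h with rfl | rfl <;> simp [productSummand, MulChar.map_zero]

theorem productSummand_self_left (hα : α ≠ 0) : productSummand B C D α β α d = 0 := by
  simp [productSummand, hα, MulChar.map_zero]

theorem productSummand_self_right (hβ : β ≠ 0) : productSummand B C D α β c β = 0 := by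
  simp [productSummand, hβ, MulChar.map_zero]

theorem appellSummand_self (hβ : β ≠ 0) : appellSummand B C D α β α β = 0 := by
  have : 1 + α - β * (1 + α) / β = 0 := by field_simp; ring
  simp [appellSummand, this, MulChar.map_zero]

theorem appellSummand_self_left (hα : α ≠ 0) (hd : d ≠ 0) (hdβ : d - β ≠ 0) :
    appellSummand B C D α β α d = (C α)⁻¹ * (D (1 + α))⁻¹ * (B d)⁻¹ := by
  have e1 : 1 + α - β * (1 + α) / d = (1 + α) * (d - β) / d := by field_simp
  have e2 : 1 + d - α * (1 + β) / α = d - β := by field_simp; ring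
  have h1 := D.apply_ne_zero hd
  have h2 := D.apply_ne_zero hdβ
  simp only [appellSummand, e1, e2, MulChar.apply_div, map_mul]
  field_simp

theorem appellSummand_self_right (hβ : β ≠ 0) (hc : c ≠ 0) (hcα : c - α ≠ 0) :
    appellSummand B C D α β c β = (B β * D β)⁻¹ * D (1 + β) * (C c * D c)⁻¹ := by
  have e1 : 1 + c - β * (1 + α) / β = c - α := by field_simp; ring
  have e2 : 1 + β - α * (1 + β) / c = (1 + β) * (c - α) / c := by field_simp
  have h2 := D.apply_ne_zero hcα
  simp only [appellSummand, e1, e2, MulChar.apply_div, map_mul]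
  field_simp

theorem appellSummand_div (hα : α ≠ 0) (hβ : β ≠ 0) (hc : c ≠ 0) (hcα : c - α ≠ 0) :
    appellSummand B C D α β c (α * β / c) =
      (B α)⁻¹ * (B β)⁻¹ * (D (-β))⁻¹ * (B c * (C c)⁻¹) := by
  have e1 : 1 + c - β * (1 + α) / (α * β / c) = -(c - α) / α := by field_simp; ring
  have e2 : 1 + α * β / c - α * (1 + β) / c = (c - α) / c := by field_simp; ring
  have h1 := D.apply_ne_zero hcα
  have h2 := D.apply_ne_zero hc
  have h3 := D.apply_ne_zero hα
  have h4 := D.apply_ne_zero hβ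
  have h5 : D (-1) ≠ 0 := D.apply_ne_zero (by simp)
  simp only [appellSummand, e1, e2, MulChar.apply_div, map_mul, ← neg_one_mul (c - α),
    ← neg_one_mul β]
  field_simp

theorem productSummand_div (hα : α ≠ 0) (hd : d ≠ 0) (hdβ : d - β ≠ 0) :
    productSummand B C D α β (α * d / (d - β)) d =
      (C α)⁻¹ * (B β)⁻¹ * (D (1 + d) * (D ((1 + α) * d + -β))⁻¹) := by
  have e1 : 1 + α * d / (d - β) = ((1 + α) * d + -β) / (d - β) := by field_simp; ring
  have e2 : 1 - α / (α * d / (d - β)) = β / d := by field_simp; ring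
  have e3 : 1 - β / d = (d - β) / d := by field_simp
  have h1 := D.apply_ne_zero hdβ
  have h2 := D.apply_ne_zero hd
  have h3 := B.apply_ne_zero hd
  have h4 := C.apply_ne_zero hd
  have h5 := C.apply_ne_zero hdβ
  simp only [productSummand, e1, e2, e3, MulChar.apply_div, map_mul]
  field_simp

theorem appellSummand_eq_productSummand (hc : c ≠ 0) (hd : d ≠ 0) (hcα : c - α ≠ 0)
    (hdβ : d - β ≠ 0) (hP : c * d - β * c - α * d ≠ 0) :
    productSummand B C D α β c d =
      appellSummand B C D α β (c * (d - β) / d) (d * (c - α) / c) := by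
  have e1 : 1 + c * (d - β) / d - β * (1 + α) / (d * (c - α) / c) =
      (c * d - β * c - α * d) * (1 + c) / (d * (c - α)) := by field_simp; ring
  have e2 : 1 + d * (c - α) / c - α * (1 + β) / (c * (d - β) / d) =
      (c * d - β * c - α * d) * (1 + d) / (c * (d - β)) := by field_simp; ring
  have e3 : 1 - α / c = (c - α) / c := by field_simp
  have e4 : 1 - β / d = (d - β) / d := by field_simp
  simp only [appellSummand, productSummand, e1, e2, e3, e4, MulChar.apply_div, map_mul]
  have hDP := D.apply_ne_zero hP
  have hDc := D.apply_ne_zero hc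
  have hDd := D.apply_ne_zero hd
  have hDα := D.apply_ne_zero hcα
  have hDβ := D.apply_ne_zero hdβ
  have hBc := B.apply_ne_zero hc
  have hBd := B.apply_ne_zero hd
  have hCc := C.apply_ne_zero hc
  have hCd := C.apply_ne_zero hd
  generalize D (c * d - β * c - α * d) = w at *
  field_simp

end Summands

section BaileyMap

variable {F : Type*} [Field F] {α β c d : F}

theorem bailey_forward_identities (hc : c ≠ 0) (hd : d ≠ 0) :
    c * (d - β) / d - α = (c * d - β * c - α * d) / d ∧
      d * (c - α) / c - β = (c * d - β * c - α * d) / c ∧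
      c * (d - β) / d * (d * (c - α) / c) - α * β = c * d - β * c - α * d := by
  refine ⟨?_, ?_, ?_⟩ <;> field_simp <;> ring

theorem bailey_backward_identities (hcα : c - α ≠ 0) (hdβ : d - β ≠ 0) :
    (c * d - α * β) / (d - β) - α = d * (c - α) / (d - β) ∧
      (c * d - α * β) / (c - α) - β = c * (d - β) / (c - α) ∧
      (c * d - α * β) / (d - β) * ((c * d - α * β) / (c - α)) -
        β * ((c * d - α * β) / (d - β)) - α * ((c * d - α * β) / (c - α)) = c * d - α * β := by
  refine ⟨?_, ?_, ?_⟩ <;> field_simp <;> ring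

end BaileyMap

open Finset in
theorem sum_productSummand_eq_sum_appellSummand {F : Type*} [Field F] [Fintype F] [DecidableEq F]
    (B C D : MulChar F ℂ) (α β : F) :
    ∑ x : F × F with x.1 ≠ 0 ∧ x.2 ≠ 0 ∧ x.1 - α ≠ 0 ∧ x.2 - β ≠ 0 ∧
        x.1 * x.2 - β * x.1 - α * x.2 ≠ 0, productSummand B C D α β x.1 x.2 =
      ∑ x : F × F with x.1 ≠ 0 ∧ x.2 ≠ 0 ∧ x.1 - α ≠ 0 ∧ x.2 - β ≠ 0 ∧
        x.1 * x.2 - α * β ≠ 0, appellSummand B C D α β x.1 x.2 := by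
  refine sum_nbij' (fun x => (x.1 * (x.2 - β) / x.2, x.2 * (x.1 - α) / x.1))
    (fun x => ((x.1 * x.2 - α * β) / (x.2 - β), (x.1 * x.2 - α * β) / (x.1 - α)))
    ?_ ?_ ?_ ?_ ?_ <;> rintro ⟨c, d⟩ h <;> simp only [mem_filter, mem_univ, true_and] at h <;>
    obtain ⟨hc, hd, hcα, hdβ, hP⟩ := h
  · obtain ⟨e1, e2, e3⟩ := bailey_forward_identities (α := α) (β := β) hc hd
    simp only [mem_filter, mem_univ, true_and, e1, e2, e3]
    refine ⟨?_, ?_, ?_, ?_, hP⟩ <;> simp_all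
  · obtain ⟨e1, e2, e3⟩ := bailey_backward_identities hcα hdβ
    simp only [mem_filter, mem_univ, true_and, e1, e2, e3]
    refine ⟨?_, ?_, ?_, ?_, hP⟩ <;> simp_all
  · obtain ⟨e1, e2, e3⟩ := bailey_forward_identities (α := α) (β := β) hc hd
    simp only [e1, e2, e3, Prod.mk.injEq]
    generalize c * d - β * c - α * d = P at *
    constructor <;> field_simp
  · obtain ⟨e1, e2, -⟩ := bailey_backward_identities hcα hdβ
    simp only [e1, e2, Prod.mk.injEq]
    constructor <;> field_simp
  · exact appellSummand_eq_productSummand B C D hc hd hcα hdβ hP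

open Finset in
theorem sum_appellSummand {F : Type*} [Field F] [Fintype F] [DecidableEq F]
    {B C D : MulChar F ℂ} (hB : B ≠ 1) (hBC : B * C⁻¹ ≠ 1) (hCD : C * D ≠ 1)
    {α β : F} (hα : α ≠ 0) (hβ : β ≠ 0) :
    ∑ c, ∑ d, appellSummand B C D α β c d =
      ∑ x : F × F with x.1 ≠ 0 ∧ x.2 ≠ 0 ∧ x.1 - α ≠ 0 ∧ x.2 - β ≠ 0 ∧
        x.1 * x.2 - α * β ≠ 0, appellSummand B C D α β x.1 x.2 -
      (C α)⁻¹ * (B β)⁻¹ * ((D (1 + α))⁻¹ + (D (-β))⁻¹ + D (1 + β) * (D α * D β)⁻¹) := by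
  have hs (c d : F) : appellSummand B C D α β c d =
      (if c ≠ 0 ∧ d ≠ 0 ∧ c - α ≠ 0 ∧ d - β ≠ 0 ∧ c * d - α * β ≠ 0 then
        appellSummand B C D α β c d else 0) +
      (if c = α then appellSummand B C D α β c d else 0) +
      (if d = β then appellSummand B C D α β c d else 0) +
      (if d = α * β / c then appellSummand B C D α β c d else 0) := by
    by_cases h0 : c = 0 ∨ d = 0
    · simp [appellSummand_of_eq_zero B C D h0]
    · obtain ⟨hc, hd⟩ := not_or.1 h0
      by_cases hcα : c = α
      · subst hcα
        by_cases hdβ : d = β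
        · subst hdβ
          simp [appellSummand_self B C D hβ]
        · have : ¬ d = c * β / c := by rwa [mul_div_cancel_left₀ _ hc]
          simp [hdβ, this]
      · by_cases hdβ : d = β
        · subst hdβ
          have : ¬ d = α * d / c := by
            rw [eq_div_iff hc, mul_comm, mul_left_inj' hd]
            exact hcα
          simp [hcα, this]
        · simp [hc, hd, hcα, hdβ, sub_eq_zero, eq_div_iff hc, mul_comm d c]
          split_ifs <;> simp_all
  have h1 : ∑ d, appellSummand B C D α β α d = -((C α)⁻¹ * (D (1 + α))⁻¹ * (B β)⁻¹) := by
    rw [← mul_neg, ← MulChar.sum_inv_ite hB, mul_sum]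
    refine sum_congr rfl fun d _ => ?_
    split_ifs with hdβ
    · rw [hdβ, appellSummand_self B C D hβ, mul_zero]
    · by_cases hd : d = 0
      · rw [appellSummand_of_eq_zero B C D (Or.inr hd), hd]
        simp [MulChar.map_zero]
      · exact appellSummand_self_left B C D hα hd (sub_ne_zero.2 hdβ)
  have h2 : ∑ c, appellSummand B C D α β c β =
      -((B β * D β)⁻¹ * D (1 + β) * (C α * D α)⁻¹) := by
    rw [← mul_neg, ← MulChar.mul_apply C D, ← MulChar.sum_inv_ite hCD, mul_sum]
    refine sum_congr rfl fun c _ => ?_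
    split_ifs with hcα
    · rw [hcα, appellSummand_self B C D hβ, mul_zero]
    · by_cases hc : c = 0
      · rw [appellSummand_of_eq_zero B C D (Or.inl hc), hc]
        simp [MulChar.map_zero]
      · exact appellSummand_self_right B C D hβ hc (sub_ne_zero.2 hcα)
  have h3 : ∑ c, appellSummand B C D α β c (α * β / c) =
      -((B α)⁻¹ * (B β)⁻¹ * (D (-β))⁻¹ * (B α * (C α)⁻¹)) := by
    rw [← mul_neg, ← MulChar.inv_apply_eq_inv' C, ← MulChar.mul_apply B,
      ← MulChar.sum_ite_eq_zero_else hBC, mul_sum]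
    refine sum_congr rfl fun c _ => ?_
    split_ifs with hcα
    · rw [hcα, mul_div_cancel_left₀ _ hα, appellSummand_self B C D hβ, mul_zero]
    · by_cases hc : c = 0
      · rw [appellSummand_of_eq_zero B C D (Or.inl hc), hc]
        simp [MulChar.map_zero]
      · simpa [MulChar.inv_apply_eq_inv'] using
          appellSummand_div B C D hα hβ hc (sub_ne_zero.2 hcα)
  have h4 : ∑ c, ∑ d, (if c = α then appellSummand B C D α β c d else 0) =
      ∑ d, appellSummand B C D α β α d := by
    rw [sum_comm]
    simp
  rw [sum_congr rfl fun c _ => sum_congr rfl fun d _ => hs c d]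
  simp only [sum_add_distrib, h4, sum_ite_eq', mem_univ, if_true, h1, h2, h3]
  rw [sum_filter, ← univ_product_univ, sum_product]
  have hBα := B.apply_ne_zero hα
  rw [mul_inv, mul_inv, mul_inv]
  field_simp
  ring

open Finset in
theorem sum_productSummand {F : Type*} [Field F] [Fintype F] [DecidableEq F]
    {B C D : MulChar F ℂ} (hD : D ≠ 1)
    {α β : F} (hα : α ≠ 0) (hβ : β ≠ 0) (hα1 : 1 + α ≠ 0) (hαβ : 1 + α + β ≠ 0) :
    ∑ c, ∑ d, productSummand B C D α β c d =
      ∑ x : F × F with x.1 ≠ 0 ∧ x.2 ≠ 0 ∧ x.1 - α ≠ 0 ∧ x.2 - β ≠ 0 ∧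
        x.1 * x.2 - β * x.1 - α * x.2 ≠ 0, productSummand B C D α β x.1 x.2 -
      (C α)⁻¹ * (B β)⁻¹ * ((D (1 + α))⁻¹ + (D (-β))⁻¹ + D (1 + β) * (D α * D β)⁻¹) := by
  have hs (c d : F) : productSummand B C D α β c d =
      (if c ≠ 0 ∧ d ≠ 0 ∧ c - α ≠ 0 ∧ d - β ≠ 0 ∧ c * d - β * c - α * d ≠ 0 then
        productSummand B C D α β c d else 0) +
      (if c = α * d / (d - β) then productSummand B C D α β c d else 0) := by
    by_cases h0 : c = 0 ∨ d = 0
    · simp [productSummand_of_eq_zero B C D h0]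
    · obtain ⟨hc, hd⟩ := not_or.1 h0
      by_cases hcα : c = α
      · simp [hcα, productSummand_self_left B C D hα]
      by_cases hdβ : d = β
      · simp [hdβ, productSummand_self_right B C D hβ]
      have hdβ' := sub_ne_zero.2 hdβ
      have h : c * d - β * c - α * d = 0 ↔ c = α * d / (d - β) := by
        rw [eq_div_iff hdβ', ← sub_eq_zero (a := c * (d - β))]
        ring_nf
      by_cases hP : c = α * d / (d - β)
      · rw [if_pos hP, if_neg (by simp [h.2 hP]), zero_add]
      · rw [if_neg hP, if_pos ⟨hc, hd, sub_ne_zero.2 hcα, hdβ', mt h.1 hP⟩, add_zero]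
  have h1 : ∑ d, productSummand B C D α β (α * d / (d - β)) d =
      (C α)⁻¹ * (B β)⁻¹ * (-(D (1 + α))⁻¹ - (D (-β))⁻¹ - D (1 + β) * (D α * D β)⁻¹) := by
    have e0 : D 1 * (D ((1 + α) * 0 + -β))⁻¹ = (D (-β))⁻¹ := by simp
    have e1 : D (1 + β) * (D ((1 + α) * β + -β))⁻¹ = D (1 + β) * (D α * D β)⁻¹ := by
      rw [← map_mul D α]
      ring_nf
    have h (d : F) : productSummand B C D α β (α * d / (d - β)) d = (C α)⁻¹ * (B β)⁻¹ *
        (D (1 + d) * (D ((1 + α) * d + -β))⁻¹ - (if d = 0 then (D (-β))⁻¹ else 0) -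
          if d = β then D (1 + β) * (D α * D β)⁻¹ else 0) := by
      by_cases hd : d = 0
      · rw [productSummand_of_eq_zero B C D (Or.inr hd), if_pos hd,
          if_neg (by rw [hd]; exact hβ.symm), hd, add_zero, e0]
        ring
      by_cases hdβ : d = β
      · rw [hdβ, productSummand_self_right B C D hβ, if_neg hβ, if_pos rfl, e1]
        ring
      · rw [if_neg hd, if_neg hdβ, sub_zero, sub_zero,
          productSummand_div B C D hα hd (sub_ne_zero.2 hdβ)]
    simp only [h, ← mul_sum, sum_sub_distrib, sum_ite_eq', mem_univ, if_true]
    rw [MulChar.sum_apply_mul_apply_inv hD hα1 (by rwa [sub_neg_eq_add])]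
  have h2 : ∑ c, ∑ d, (if c = α * d / (d - β) then productSummand B C D α β c d else 0) =
      ∑ d, productSummand B C D α β (α * d / (d - β)) d := by
    rw [sum_comm]
    simp
  rw [sum_congr rfl fun c _ => sum_congr rfl fun d _ => hs c d]
  simp only [sum_add_distrib, h2, h1]
  rw [sum_filter, ← univ_product_univ, sum_product]
  ring

theorem sum_appellSummand_eq_sum_productSummand {F : Type*} [Field F] [Fintype F] [DecidableEq F]
    {B C D : MulChar F ℂ} (hB : B ≠ 1) (hD : D ≠ 1) (hBC : B * C⁻¹ ≠ 1) (hCD : C * D ≠ 1)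
    {α β : F} (hα : α ≠ 0) (hβ : β ≠ 0) (hα1 : 1 + α ≠ 0) (hαβ : 1 + α + β ≠ 0) :
    ∑ c, ∑ d, appellSummand B C D α β c d = ∑ c, ∑ d, productSummand B C D α β c d := by
  rw [sum_appellSummand hB hBC hCD hα hβ, sum_productSummand hD hα hβ hα1 hαβ,
    sum_productSummand_eq_sum_appellSummand]

/-- The additive character `addCharTheta`, bundled. -/
noncomputable def thetaAddChar {p : ℕ} [NeZero p] (F : Type*) [Field F] [Algebra (ZMod p) F]
    {zeta : ℂ} (hzeta : IsPrimitiveRoot zeta p) : AddChar F ℂ :=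
  (AddChar.zmodChar p hzeta.pow_eq_one).compAddMonoidHom
    (Algebra.trace (ZMod p) F).toAddMonoidHom

section Normalization

variable {p : ℕ} {F : Type*} [Field F] [Fintype F] [Algebra (ZMod p) F] {zeta : ℂ}

theorem gaussS_eq_gaussSum [NeZero p] (hzeta : IsPrimitiveRoot zeta p)
    (χ : MulChar F ℂ) :
    gaussS p F zeta χ = gaussSum χ (thetaAddChar F hzeta) := rfl

theorem card_sub_one_ne_zero (F : Type*) [Field F] [Fintype F] :
    (Fintype.card F : ℂ) - 1 ≠ 0 := by
  have := Fintype.one_lt_card (α := F)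
  rw [sub_ne_zero]
  exact_mod_cast this.ne'

theorem mcCarthy2F1_zero (A B C : MulChar F ℂ) : mcCarthy2F1 p F zeta A B C 0 = 0 := by
  simp [mcCarthy2F1, MulChar.map_zero]

theorem mcCarthy2F1_comm (A B C : MulChar F ℂ) (z : F) :
    mcCarthy2F1 p F zeta A B C z = mcCarthy2F1 p F zeta B A C z := by
  unfold mcCarthy2F1
  refine congrArg _ (Finset.sum_congr rfl fun χ _ => ?_)
  rw [mul_comm (gaussS p F zeta (A * χ)), mul_comm (gaussS p F zeta A)]

theorem appellF4star_zero_left (A B C C' : MulChar F ℂ) (y : F) :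
    appellF4star p F zeta A B C C' 0 y = 0 := by
  simp [appellF4star, MulChar.map_zero]

theorem appellF4star_zero_right (A B C C' : MulChar F ℂ) (x : F) :
    appellF4star p F zeta A B C C' x 0 = 0 := by
  simp [appellF4star, MulChar.map_zero]

theorem mcCarthy2F1_eq_sum [NeZero p] (hzeta : IsPrimitiveRoot zeta p)
    {A B C : MulChar F ℂ} (hB : B ≠ 1) (hAC : A * C⁻¹ ≠ 1) {z : F} (hz : z ≠ 0) :
    mcCarthy2F1 p F zeta A B C z =
      gaussS p F zeta (A * C⁻¹) * gaussS p F zeta B /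
        (gaussS p F zeta A * gaussS p F zeta B * gaussS p F zeta C⁻¹) *
      ∑ c : F, C⁻¹ c * (((A * C⁻¹) (1 + c))⁻¹ * (B (1 + z / c))⁻¹) := by
  classical
  have hq := card_sub_one_ne_zero F
  simp only [mcCarthy2F1, gaussS_eq_gaussSum hzeta, div_mul_eq_mul_div _ _ (_ : ℂ),
    ← Finset.sum_div]
  rw [sum_gaussSum_twoFOne _ hB hAC hz]
  field_simp

theorem appellF4star_eq_sum [NeZero p] (hzeta : IsPrimitiveRoot zeta p)
    {A B C : MulChar F ℂ} (hAC : A * C⁻¹ ≠ 1) {x y : F} (hx : x ≠ 0) (hy : y ≠ 0) :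
    appellF4star p F zeta A B C (A * B * C⁻¹) x y =
      gaussS p F zeta (A * C⁻¹) * gaussS p F zeta (A * C⁻¹)⁻¹ /
        (gaussS p F zeta A * gaussS p F zeta B * gaussS p F zeta C⁻¹ *
          gaussS p F zeta (A * B * C⁻¹)⁻¹) *
      ∑ c : F, ∑ d : F, C⁻¹ c * (A * B * C⁻¹)⁻¹ d *
        (((A * C⁻¹) (1 + c + y / d))⁻¹ * (A * C⁻¹) (1 + d + x / c)) := by
  classical
  have hq := card_sub_one_ne_zero F
  simp only [appellF4star, gaussS_eq_gaussSum hzeta, div_mul_eq_mul_div _ _ (_ : ℂ),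
    ← Finset.sum_div]
  rw [sum_gaussSum_appellFour _ hAC hx hy]
  field_simp

end Normalization

theorem stmt2    (p : ℕ) [Fact p.Prime] (hp : p ≠ 2) (F : Type*) [Field F] [Fintype F]
    [Algebra (ZMod p) F] (zeta : ℂ) (hzeta : IsPrimitiveRoot zeta p)
    (A B C : MulChar F ℂ) (hA : A ≠ 1) (hB : B ≠ 1) (hC : C ≠ 1) (hBC : B ≠ C)
    (hAC : A ≠ C) (x y : F) (hx : x ≠ 1) (hy : y ≠ 1) (hxy : x * y ≠ 1) :
    appellF4star p F zeta A B C (A * B * C⁻¹)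
        (-x / ((1 - x) * (1 - y))) (-y / ((1 - x) * (1 - y))) =
    mcCarthy2F1 p F zeta A B C (-x / (1 - x)) *
      mcCarthy2F1 p F zeta A B (A * B * C⁻¹) (-y / (1 - y)) := by
  classical
  rcases eq_or_ne x 0 with rfl | hx0
  · simp [appellF4star_zero_left, mcCarthy2F1_zero]
  rcases eq_or_ne y 0 with rfl | hy0
  · simp [appellF4star_zero_right, mcCarthy2F1_zero]
  have hx1 : 1 - x ≠ 0 := sub_ne_zero.2 hx.symm
  have hy1 : 1 - y ≠ 0 := sub_ne_zero.2 hy.symm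
  obtain ⟨α, hα⟩ : ∃ α, α = x / (1 - x) := ⟨_, rfl⟩
  obtain ⟨β, hβ⟩ : ∃ β, β = y / (1 - y) := ⟨_, rfl⟩
  have hα0 : α ≠ 0 := hα ▸ div_ne_zero hx0 hx1
  have hβ0 : β ≠ 0 := hβ ▸ div_ne_zero hy0 hy1
  have hα1 : 1 + α ≠ 0 := by
    rw [hα, show 1 + x / (1 - x) = 1 / (1 - x) by field_simp; ring]
    exact one_div_ne_zero hx1
  have hβ1 : 1 + β ≠ 0 := by
    rw [hβ, show 1 + y / (1 - y) = 1 / (1 - y) by field_simp; ring]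
    exact one_div_ne_zero hy1
  have hαβ : 1 + α + β ≠ 0 := by
    rw [hα, hβ, show 1 + x / (1 - x) + y / (1 - y) = (1 - x * y) / ((1 - x) * (1 - y)) by
      field_simp; ring]
    exact div_ne_zero (sub_ne_zero.2 hxy.symm) (mul_ne_zero hx1 hy1)
  have eX : -x / ((1 - x) * (1 - y)) = -(α * (1 + β)) := by
    rw [hα, hβ]; field_simp; ring
  have eY : -y / ((1 - x) * (1 - y)) = -(β * (1 + α)) := by
    rw [hα, hβ]; field_simp; ring
  have ex : -x / (1 - x) = -α := by rw [hα, neg_div]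
  have ey : -y / (1 - y) = -β := by rw [hβ, neg_div]
  have hD : A * C⁻¹ ≠ 1 := mul_inv_eq_one.not.2 hAC
  have hBD : B * (A * B * C⁻¹)⁻¹ = (A * C⁻¹)⁻¹ := by
    rw [mul_right_comm, mul_inv, mul_left_comm, mul_inv_cancel, mul_one]
  have hCD : C * (A * C⁻¹) = A := by rw [mul_left_comm, mul_inv_cancel, mul_one]
  have hABC : A * B * C⁻¹ = B * (A * C⁻¹) := by rw [mul_comm A, mul_assoc]
  have key := sum_appellSummand_eq_sum_productSummand hB hD (mul_inv_eq_one.not.2 hBC)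
    (hCD.symm ▸ hA) hα0 hβ0 hα1 hαβ
  simp only [appellSummand, productSummand, ← MulChar.mul_apply B, ← MulChar.mul_apply C, hCD,
    ← hABC, ← Finset.sum_mul_sum] at key
  rw [eX, eY, ex, ey, mcCarthy2F1_comm A B (A * B * C⁻¹),
    appellF4star_eq_sum hzeta hD (neg_ne_zero.2 (mul_ne_zero hα0 hβ1))
      (neg_ne_zero.2 (mul_ne_zero hβ0 hα1)),
    mcCarthy2F1_eq_sum hzeta hB hD (neg_ne_zero.2 hα0),
    mcCarthy2F1_eq_sum hzeta hA (hBD ▸ inv_ne_one.2 hD) (neg_ne_zero.2 hβ0), hBD]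
  simp only [neg_div, ← sub_eq_add_neg, MulChar.inv_apply_eq_inv', inv_inv]
  rw [key, mul_mul_mul_comm]
  generalize gaussS p F zeta A = a
  generalize gaussS p F zeta B = b
  generalize gaussS p F zeta C⁻¹ = c
  refine congrArg (· * _) ?_
  by_cases ha : a = 0
  · simp [ha]
  by_cases hb : b = 0
  · simp [hb]
  field_simp
end

section
/- Let A₀, A₁ be multiplicative characters on F_q with A₀ ≠ ε and A₁ ≠ ε, and let x ∈ F_q with x ≠ 0. Then ₂F₁*(A₀, A₁; A₁ | x) = -Ā₁(x) · (A₀Ā₁ choose Ā₁) + Ā₀(1-x). -/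
namespace MulChar

/-- Orthogonality relation: the sum of all complex multiplicative characters of a finite field
at a point. -/
theorem sum_apply_eq_ite {F : Type*} [Field F] [Fintype F] [DecidableEq F] (a : F) :
    ∑ χ : MulChar F ℂ, χ a = if a = 1 then (Fintype.card F : ℂ) - 1 else 0 := by
  split_ifs with h
  · subst h
    have hcard : Fintype.card (MulChar F ℂ) = Fintype.card F - 1 := by
      rw [← Nat.card_eq_fintype_card, card_eq_card_units_of_hasEnoughRootsOfUnity,
        Nat.card_units, Nat.card_eq_fintype_card]
    simp [hcard, Nat.cast_sub Fintype.card_pos]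
  · obtain ⟨φ, hφ⟩ := exists_apply_ne_one_of_hasEnoughRootsOfUnity F ℂ h
    refine eq_zero_of_mul_eq_self_left hφ ?_
    rw [Finset.mul_sum]
    exact Fintype.sum_equiv (Equiv.mulLeft φ) _ _ fun χ ↦ (mul_apply φ χ a).symm

end MulChar

section GaussSums

variable {F : Type*} [Field F] [Fintype F]

theorem gaussSum_mul_gaussSum_inv {χ : MulChar F ℂ} (hχ : χ ≠ 1) {ψ : AddChar F ℂ}
    (hψ : ψ.IsPrimitive) :
    gaussSum χ ψ * gaussSum χ⁻¹ ψ = χ (-1) * Fintype.card F := by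
  rw [← mul_gaussSum_inv_eq_gaussSum χ⁻¹ ψ, mul_left_comm,
    gaussSum_mul_gaussSum_eq_card hχ hψ, MulChar.inv_apply', inv_neg_one]

/-- The product formula for Gauss sums of inverse characters, with the correction term at the
trivial character. -/
theorem gaussSum_mul_gaussSum_inv_eq_add_ite [DecidableEq (MulChar F ℂ)] (χ : MulChar F ℂ)
    {ψ : AddChar F ℂ} (hψ : ψ.IsPrimitive) :
    gaussSum χ ψ * gaussSum χ⁻¹ ψ =
      χ (-1) * Fintype.card F + if χ = 1 then 1 - (Fintype.card F : ℂ) else 0 := by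
  split_ifs with h
  · have hψ1 : ψ ≠ 1 := by simpa using hψ one_ne_zero
    rw [h, inv_one, gaussSum_one_left hψ1, MulChar.one_apply isUnit_one.neg]
    ring
  · rw [gaussSum_mul_gaussSum_inv h hψ, add_zero]

/-- A finite field analogue of the binomial theorem, in terms of Gauss sums. -/
theorem sum_gaussSum_mul_gaussSum_inv_mul_apply {A : MulChar F ℂ} (hA : A ≠ 1)
    (ψ : AddChar F ℂ) {x : F} (hx : x ≠ 0) :
    ∑ χ : MulChar F ℂ, gaussSum (A * χ) ψ * gaussSum χ⁻¹ ψ * χ (-x) =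
      ((Fintype.card F : ℂ) - 1) * (A⁻¹ (1 - x) * gaussSum A ψ) := by
  classical
  have key (u v : F) : ∑ χ : MulChar F ℂ, (A * χ) u * ψ u * (χ⁻¹ v * ψ v) * χ (-x) =
      if v = u * -x then ((Fintype.card F : ℂ) - 1) * (A u * ψ (u * (1 - x))) else 0 := by
    rcases eq_or_ne u 0 with rfl | hu
    · simp only [MulChar.map_zero, zero_mul, Finset.sum_const_zero, mul_zero, ite_self]
    calc
      _ = A u * (ψ u * ψ v) * ∑ χ : MulChar F ℂ, χ (u * v⁻¹ * -x) := by
        rw [Finset.mul_sum]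
        refine Finset.sum_congr rfl fun χ _ ↦ ?_
        rw [map_mul, map_mul, MulChar.mul_apply, MulChar.inv_apply']
        ring
      _ = _ := by
        rw [MulChar.sum_apply_eq_ite, ← AddChar.map_add_eq_mul]
        have hiff : u * v⁻¹ * -x = 1 ↔ v = u * -x := by
          rcases eq_or_ne v 0 with rfl | hv
          · simp [hu, hx]
          · field_simp
            exact eq_comm
        simp only [hiff]
        split_ifs with h
        · rw [h]
          ring_nf
        · rw [mul_zero]
  calc
    _ = ∑ u : F, ∑ v : F, ∑ χ : MulChar F ℂ, (A * χ) u * ψ u * (χ⁻¹ v * ψ v) * χ (-x) := by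
      simp only [gaussSum, Finset.sum_mul_sum]
      simp only [Finset.sum_mul]
      rw [Finset.sum_comm]
      exact Finset.sum_congr rfl fun u _ ↦ Finset.sum_comm
    _ = ((Fintype.card F : ℂ) - 1) * gaussSum A (ψ.mulShift (1 - x)) := by
      simp only [key, Finset.sum_ite_eq', Finset.mem_univ, if_true,
        gaussSum, Finset.mul_sum, AddChar.mulShift_apply, mul_comm (1 - x)]
    _ = _ := by
      rcases eq_or_ne (1 - x) 0 with h | h
      · rw [h, AddChar.mulShift_zero, gaussSum_one_right hA, MulChar.map_zero, zero_mul]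
      · rw [← Units.val_mk0 h, gaussSum_mulShift_eq]

end GaussSums

section Theta

variable (p : ℕ) [Fact p.Prime] (F : Type*) [Field F] [Fintype F] [Algebra (ZMod p) F]

theorem exists_isPrimitive_forall_eq_addCharTheta {zeta : ℂ} (hzeta : IsPrimitiveRoot zeta p) :
    ∃ ψ : AddChar F ℂ, ψ.IsPrimitive ∧ ∀ a, ψ a = addCharTheta p F zeta a := by
  let φ : AddChar (ZMod p) ℂ := AddChar.zmodChar p hzeta.pow_eq_one
  let ψ : AddChar F ℂ := φ.compAddMonoidHom (Algebra.trace (ZMod p) F).toAddMonoidHom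
  have hφ : φ ≠ 1 := by
    simpa using AddChar.zmodChar_primitive_of_primitive_root p hzeta one_ne_zero
  refine ⟨ψ, AddChar.IsPrimitive.of_ne_one ?_, fun a ↦ rfl⟩
  obtain ⟨b, hb⟩ := AddChar.ne_one_iff.mp hφ
  obtain ⟨a, rfl⟩ := Algebra.trace_surjective (ZMod p) F b
  exact AddChar.ne_one_iff.mpr ⟨a, hb⟩

end Theta

theorem stmt7    (p : ℕ) [Fact p.Prime] (hp : p ≠ 2) (F : Type*) [Field F] [Fintype F]
    [Algebra (ZMod p) F] (zeta : ℂ) (hzeta : IsPrimitiveRoot zeta p)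
    (A₀ A₁ : MulChar F ℂ) (hA₀ : A₀ ≠ 1) (hA₁ : A₁ ≠ 1) (x : F) (hx0 : x ≠ 0) :
    mcCarthy2F1 p F zeta A₀ A₁ A₁ x =
    -(A₁⁻¹ x * binomChar F (A₀ * A₁⁻¹) A₁⁻¹) + A₀⁻¹ (1 - x) := by
  classical
  obtain ⟨ψ, hψ, hψθ⟩ := exists_isPrimitive_forall_eq_addCharTheta p F hzeta
  have hg (χ : MulChar F ℂ) : gaussS p F zeta χ = gaussSum χ ψ := by
    simp only [gaussS, gaussSum, hψθ]
  have hq : (Fintype.card F : ℂ) ≠ 0 := Nat.cast_ne_zero.mpr Fintype.card_ne_zero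
  have hq1 : (Fintype.card F : ℂ) - 1 ≠ 0 :=
    sub_ne_zero.mpr (Nat.cast_ne_one.mpr Fintype.one_lt_card.ne')
  have hg₀ : gaussSum A₀ ψ ≠ 0 := gaussSum_ne_zero_of_nontrivial hq hA₀ hψ
  have hneg0 : A₁ (-1) ≠ 0 := (isUnit_one.neg.map A₁).ne_zero
  have hJ : jacobiS F (A₀ * A₁⁻¹) A₁⁻¹⁻¹ =
      gaussSum (A₀ * A₁⁻¹) ψ * gaussSum A₁ ψ / gaussSum A₀ ψ := by
    rw [inv_inv]
    have h := jacobiSum_eq_gaussSum_mul_gaussSum_div_gaussSum hq (χ := A₀ * A₁⁻¹) (φ := A₁)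
      (by rwa [inv_mul_cancel_right]) hψ
    rwa [inv_mul_cancel_right] at h
  have hterm (χ : MulChar F ℂ) :
      gaussSum (A₀ * χ) ψ * gaussSum (A₁ * χ) ψ * gaussSum (A₁ * χ)⁻¹ ψ * gaussSum χ⁻¹ ψ /
          (gaussSum A₀ ψ * gaussSum A₁ ψ * gaussSum A₁⁻¹ ψ) * χ x =
        (gaussSum A₀ ψ)⁻¹ * (gaussSum (A₀ * χ) ψ * gaussSum χ⁻¹ ψ * χ (-x)) +
          if χ = A₁⁻¹ then (1 - (Fintype.card F : ℂ)) *
            (gaussSum (A₀ * A₁⁻¹) ψ * gaussSum A₁ ψ * A₁⁻¹ x /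
              (gaussSum A₀ ψ * (A₁ (-1) * Fintype.card F))) else 0 := by
    rw [mul_assoc (gaussSum (A₀ * χ) ψ), gaussSum_mul_gaussSum_inv_eq_add_ite _ hψ,
      mul_assoc (gaussSum A₀ ψ), gaussSum_mul_gaussSum_inv hA₁ hψ, MulChar.mul_apply,
      ← neg_one_mul x, map_mul χ (-1) x]
    simp only [mul_eq_one_iff_eq_inv']
    split_ifs with h
    · subst h
      rw [inv_inv]
      field_simp
    · field_simp
      ring
  unfold mcCarthy2F1 binomChar
  simp only [hg, hterm]
  rw [Finset.sum_add_distrib, ← Finset.mul_sum, Finset.sum_ite_eq',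
    if_pos (Finset.mem_univ _), sum_gaussSum_mul_gaussSum_inv_mul_apply hA₀ ψ hx0, hJ,
    MulChar.inv_apply_eq_inv' A₁ (-1)]
  field_simp
  ring
end
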